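/- For every node i not in I, v_i ≤ c · max_{j ∈ I} v_j (in particular, if I is nonempty the maximum of v over all nodes is attained on I). -/

import Mathlib

open Matrix Finset

/-- Outdegree of node `i` in the edge set `E`. -/
def outdeg {n : ℕ} (E : Finset (Fin n × Fin n)) (i : Fin n) : ℕ :=
  (Finset.univ.filter (fun j => (i, j) ∈ E)).card

/-- The scaled adjacency matrix `P` of the graph: `P i j = 1 / outdeg i` if `(i,j) ∈ E`. -/
noncomputable def Pmat {n : ℕ} (E : Finset (Fin n × Fin n)) : Matrix (Fin n) (Fin n) ℝ :=
  fun i j => if (i, j) ∈ E then ((outdeg E i : ℝ))⁻¹ else 0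

/-- Indicator vector of a set of nodes. -/
def ind {n : ℕ} (I : Finset (Fin n)) : Fin n → ℝ :=
  fun i => if i ∈ I then 1 else 0

/-- `v = (Id - cP)⁻¹ e_I`, the vector of mean numbers of visits to `I` before zapping. -/
noncomputable def vvec {n : ℕ} (c : ℝ) (E : Finset (Fin n × Fin n)) (I : Finset (Fin n)) : Fin n → ℝ :=
  (1 - c • Pmat E)⁻¹ *ᵥ ind I

/-- PageRank vector `πᵀ = (1-c) zᵀ (Id - cP)⁻¹`. -/
noncomputable def pr {n : ℕ} (c : ℝ) (z : Fin n → ℝ) (E : Finset (Fin n × Fin n)) : Fin n → ℝ :=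
  (1 - c) • (((1 - c • Pmat E)⁻¹)ᵀ *ᵥ z)

/-- PageRank of the set `I`: `πᵀ e_I`. -/
noncomputable def prSet {n : ℕ} (c : ℝ) (z : Fin n → ℝ) (E : Finset (Fin n × Fin n))
    (I : Finset (Fin n)) : ℝ :=
  ∑ i ∈ I, pr c z E i

/-- Node `i` has access to (some node of) the set `J`: `i ∈ J` or a directed path from `i`
reaches `J`. -/
def access {n : ℕ} (E : Finset (Fin n × Fin n)) (i : Fin n) (J : Finset (Fin n)) : Prop :=
  ∃ j ∈ J, Relation.ReflTransGen (fun a b => (a, b) ∈ E) i j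

theorem aux_row {n : ℕ} (E : Finset (Fin n × Fin n)) (hE : ∀ i, 0 < outdeg E i) (i : Fin n) :
    ∑ j, Pmat E i j = 1 := by
  have h : (outdeg E i : ℝ) ≠ 0 := by exact_mod_cast (hE i).ne'
  unfold Pmat
  rw [← Finset.sum_filter, Finset.sum_const, nsmul_eq_mul]
  exact mul_inv_cancel₀ h

theorem aux_le {n : ℕ} (E : Finset (Fin n × Fin n)) (hE : ∀ i, 0 < outdeg E i)
    (w : Fin n → ℝ) (M : ℝ) (hM : ∀ k, w k ≤ M) (i : Fin n) : (Pmat E *ᵥ w) i ≤ M := by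
  have h1 : ∑ j, Pmat E i j * w j ≤ ∑ j, Pmat E i j * M := by
    apply Finset.sum_le_sum
    intro j _
    apply mul_le_mul_of_nonneg_left (hM j)
    unfold Pmat
    split_ifs <;> positivity
  rw [← Finset.sum_mul, aux_row E hE i, one_mul] at h1
  exact h1

theorem aux_nonpos {n : ℕ} (E : Finset (Fin n × Fin n)) (hE : ∀ i, 0 < outdeg E i)
    (c : ℝ) (hc0 : 0 < c) (hc1 : c < 1) (w : Fin n → ℝ)
    (hw : ∀ i, w i ≤ c * (Pmat E *ᵥ w) i) (i : Fin n) : w i ≤ 0 := by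
  obtain ⟨m, -, hm⟩ := Finset.exists_max_image Finset.univ w ⟨i, Finset.mem_univ i⟩
  have h1 := aux_le E hE w (w m) (fun k => hm k (Finset.mem_univ k)) m
  have h2 := mul_le_mul_of_nonneg_left h1 hc0.le
  have h3 := hw m
  have h4 := hm i (Finset.mem_univ i)
  nlinarith

theorem aux_unit {n : ℕ} (E : Finset (Fin n × Fin n)) (hE : ∀ i, 0 < outdeg E i)
    (c : ℝ) (hc0 : 0 < c) (hc1 : c < 1) : IsUnit (1 - c • Pmat E) := by
  rw [← Matrix.mulVec_injective_iff_isUnit]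
  intro x y hxy
  have key : ∀ x y : Fin n → ℝ, (1 - c • Pmat E) *ᵥ x = (1 - c • Pmat E) *ᵥ y →
      ∀ i, x i ≤ y i := by
    intro x y hxy i
    have := aux_nonpos E hE c hc0 hc1 (x - y) (fun i => by
      have h := congrFun hxy i
      simp only [Matrix.sub_mulVec, Matrix.one_mulVec, Matrix.smul_mulVec, Pi.sub_apply,
        Pi.smul_apply, smul_eq_mul, Matrix.mulVec_sub] at h ⊢
      linarith) i
    simpa using this
  funext i
  exact le_antisymm (key x y hxy i) (key y x hxy.symm i)

theorem aux_eq {n : ℕ} (E : Finset (Fin n × Fin n)) (hE : ∀ i, 0 < outdeg E i)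
    (c : ℝ) (hc0 : 0 < c) (hc1 : c < 1) (I : Finset (Fin n)) (i : Fin n) :
    vvec c E I i = c * (Pmat E *ᵥ vvec c E I) i + ind I i := by
  have hu := (Matrix.isUnit_iff_isUnit_det _).1 (aux_unit E hE c hc0 hc1)
  have h : (1 - c • Pmat E) *ᵥ vvec c E I = ind I := by
    unfold vvec
    rw [Matrix.mulVec_mulVec, Matrix.mul_nonsing_inv _ hu, Matrix.one_mulVec]
  have h := congrFun h i
  simp only [Matrix.sub_mulVec, Matrix.one_mulVec, Matrix.smul_mulVec, Pi.sub_apply,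
        Pi.smul_apply, smul_eq_mul] at h
  linarith

/-- Lemma 1(a): for every node `i ∉ I`, `v i ≤ c * max_{j ∈ I} v j`; in particular the
maximum of `v` over all nodes is attained on `I`. -/
theorem stmt0 {n : ℕ} (hn : 1 ≤ n) (E : Finset (Fin n × Fin n))
    (hE : ∀ i, 0 < outdeg E i) (c : ℝ) (hc0 : 0 < c) (hc1 : c < 1)
    (I : Finset (Fin n)) (hI : I.Nonempty) :
    (∀ i, i ∉ I → vvec c E I i ≤ c * I.sup' hI (vvec c E I)) ∧
      ∃ j ∈ I, ∀ k, vvec c E I k ≤ vvec c E I j := by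
  have heq := aux_eq E hE c hc0 hc1 I
  obtain ⟨m, -, hm⟩ := Finset.exists_max_image Finset.univ (vvec c E I)
    ⟨hI.choose, Finset.mem_univ _⟩
  have hm : ∀ k, vvec c E I k ≤ vvec c E I m := fun k => hm k (Finset.mem_univ k)
  have hle : ∀ i, i ∉ I → vvec c E I i ≤ c * vvec c E I m := by
    intro i hi
    have h1 := heq i
    have h2 := mul_le_mul_of_nonneg_left (aux_le E hE _ _ hm i) hc0.le
    have h3 : ind I i = 0 := by simp [ind, hi]
    linarith
  have hnn : ∀ i, 0 ≤ vvec c E I i := by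
    intro i
    have := aux_nonpos E hE c hc0 hc1 (-vvec c E I) (fun i => by
      have h1 := heq i
      have h3 : 0 ≤ ind I i := by unfold ind; split_ifs <;> norm_num
      simp only [Matrix.mulVec_neg, Pi.neg_apply]
      linarith) i
    simpa using this
  have hmI : m ∈ I := by
    by_contra hmI
    have h1 := hle m hmI
    obtain ⟨j, hj⟩ := hI
    have h2 := hm j
    have h3 := heq j
    have h4 : ind I j = 1 := by simp [ind, hj]
    have h5 := aux_le E hE (-vvec c E I) 0 (fun k => by simpa using hnn k) j
    simp only [Matrix.mulVec_neg, Pi.neg_apply] at h5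
    have h6 : 0 ≤ c * (Pmat E *ᵥ vvec c E I) j := mul_nonneg hc0.le (by linarith)
    have h7 : 1 ≤ vvec c E I m := by linarith
    nlinarith
  refine ⟨fun i hi => (hle i hi).trans ?_, m, hmI, hm⟩
  exact mul_le_mul_of_nonneg_left (Finset.le_sup' (vvec c E I) hmI) hc0.le
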